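/- Let ν and κ be probability measures on measurable spaces X and Y respectively, and let Q, w : X × Y → ℝ be measurable with w ≥ 0 (ν ⊗ κ)-a.e., such that w, Qw, Q²w are (ν ⊗ κ)-integrable, and for κ-a.e. y the slice integrals ∫ w(x,y) dν(x) are positive. Define b*(y) = (∫ Q(x,y)·w(x,y) dν(x)) / (∫ w(x,y) dν(x)). Then for every measurable function b : Y → ℝ for which (x,y) ↦ w(x,y)·(Q(x,y) − b(y))² is (ν ⊗ κ)-integrable, ∫ w·(Q − b*∘pr₂)² d(ν ⊗ κ) ≤ ∫ w·(Q − b∘pr₂)² d(ν ⊗ κ). -/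

import Mathlib

open MeasureTheory

/-- The weighted second moment of `q` about `c`, expanded as a quadratic polynomial in `c`. -/
theorem integral_mul_sub_const_sq {α : Type*} [MeasurableSpace α] {μ : Measure α} {q v : α → ℝ}
    (hv : Integrable v μ) (hqv : Integrable (fun a => q a * v a) μ)
    (hq2v : Integrable (fun a => q a ^ 2 * v a) μ) (c : ℝ) :
    ∫ a, v a * (q a - c) ^ 2 ∂μ
      = ∫ a, q a ^ 2 * v a ∂μ - 2 * c * ∫ a, q a * v a ∂μ + c ^ 2 * ∫ a, v a ∂μ := by
  have expand : (fun a => v a * (q a - c) ^ 2)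
      = fun a => q a ^ 2 * v a - 2 * c * (q a * v a) + c ^ 2 * v a := by
    funext a
    ring
  have hsub : Integrable (fun a => q a ^ 2 * v a - 2 * c * (q a * v a)) μ :=
    hq2v.sub (hqv.const_mul _)
  rw [expand, integral_add hsub (hv.const_mul _), integral_sub hq2v (hqv.const_mul _),
    integral_const_mul, integral_const_mul]

/-- The weighted mean minimizes the weighted second moment. -/
theorem integral_mul_sub_weighted_mean_sq_le {α : Type*} [MeasurableSpace α] {μ : Measure α}
    {q v : α → ℝ} (hv : Integrable v μ) (hqv : Integrable (fun a => q a * v a) μ)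
    (hq2v : Integrable (fun a => q a ^ 2 * v a) μ) (hpos : 0 < ∫ a, v a ∂μ) (c : ℝ) :
    ∫ a, v a * (q a - (∫ a, q a * v a ∂μ) / ∫ a, v a ∂μ) ^ 2 ∂μ
      ≤ ∫ a, v a * (q a - c) ^ 2 ∂μ := by
  rw [integral_mul_sub_const_sq hv hqv hq2v, integral_mul_sub_const_sq hv hqv hq2v]
  set m := (∫ a, q a * v a ∂μ) / ∫ a, v a ∂μ with hm
  have hmean : ∫ a, q a * v a ∂μ = m * ∫ a, v a ∂μ := by
    rw [hm, div_mul_cancel₀ _ hpos.ne']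
  rw [hmean]
  nlinarith [mul_nonneg hpos.le (sq_nonneg (c - m))]

/-- Conditioned minimum-variance baseline: the baseline is allowed to depend on the
`Y`-coordinate, and the conditional weighted mean
`b*(y) = (∫ Q(x,y)·w(x,y) dν(x)) / (∫ w(x,y) dν(x))` minimizes the weighted second
moment over all such baselines. -/
theorem conditioned_min_variance_baseline
    {X Y : Type*} [MeasurableSpace X] [MeasurableSpace Y]
    (ν : Measure X) (κ : Measure Y)
    [IsProbabilityMeasure ν] [IsProbabilityMeasure κ]
    (Q w : X × Y → ℝ) (hQm : Measurable Q) (hwm : Measurable w)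
    (hw0 : ∀ᵐ p ∂(ν.prod κ), 0 ≤ w p)
    (hw : Integrable w (ν.prod κ))
    (hQw : Integrable (fun p => Q p * w p) (ν.prod κ))
    (hQ2w : Integrable (fun p => Q p ^ 2 * w p) (ν.prod κ))
    (hslice : ∀ᵐ y ∂κ, 0 < ∫ x, w (x, y) ∂ν) :
    ∀ b : Y → ℝ, Measurable b →
      Integrable (fun p : X × Y => w p * (Q p - b p.2) ^ 2) (ν.prod κ) →
      (∫ p : X × Y,
          w p * (Q p - (∫ x, Q (x, p.2) * w (x, p.2) ∂ν) / (∫ x, w (x, p.2) ∂ν)) ^ 2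
            ∂(ν.prod κ))
        ≤ ∫ p : X × Y, w p * (Q p - b p.2) ^ 2 ∂(ν.prod κ) := by
  intro b _ hb
  by_cases hopt : Integrable (fun p : X × Y =>
      w p * (Q p - (∫ x, Q (x, p.2) * w (x, p.2) ∂ν) / (∫ x, w (x, p.2) ∂ν)) ^ 2) (ν.prod κ)
  · rw [integral_prod_symm _ hopt, integral_prod_symm _ hb]
    refine integral_mono_ae hopt.integral_prod_right hb.integral_prod_right ?_
    filter_upwards [hw.prod_left_ae, hQw.prod_left_ae, hQ2w.prod_left_ae, hslice]
      with y h₀ h₁ h₂ hpos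
    exact integral_mul_sub_weighted_mean_sq_le h₀ h₁ h₂ hpos (b y)
  · rw [integral_undef hopt]
    refine integral_nonneg_of_ae ?_
    filter_upwards [hw0] with p hp
    exact mul_nonneg hp (sq_nonneg _)
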